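/- Let N ≥ 1 be an integer. There exists a constant C > 0 (depending only on N) such that for every smooth function f : ℝ^N → ℝ whose support is a compact subset of the open unit ball B₁ = {y ∈ ℝ^N : |y| < 1}, one has ∫_{B₁} f(y)² / (1 − |y|²)² dy ≤ C ∫_{B₁} |∇f(y)|² dy. -/

import Mathlib

open MeasureTheory

/-- In dimension `N`, `∫ Dh(x) x dx = -N ∫ h` for compactly supported `C¹` functions `h`. -/
lemma integral_fderiv_apply_self {N : ℕ} {h : EuclideanSpace ℝ (Fin N) → ℝ}
    (hh : ContDiff ℝ 1 h) (hc : HasCompactSupport h) :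
    ∫ x, fderiv ℝ h x x = -(N * ∫ x, h x) := by
  have hd : Continuous (fderiv ℝ h) := hh.continuous_fderiv one_ne_zero
  have hdc : HasCompactSupport (fderiv ℝ h) := hc.fderiv ℝ
  have hi (i : Fin N) :
      Integrable fun x => fderiv ℝ h x (EuclideanSpace.single i 1) * x i := by
    refine Continuous.integrable_of_hasCompactSupport (by fun_prop) (hdc.mono' ?_)
    refine subset_trans (fun x hx => ?_) (subset_tsupport _)
    contrapose! hx
    simp [Function.notMem_support.mp hx]
  have hparts (i : Fin N) :
      ∫ x, fderiv ℝ h x (EuclideanSpace.single i 1) * x i = -∫ x, h x := by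
    have hp (x : EuclideanSpace ℝ (Fin N)) :
        HasFDerivAt (fun y : EuclideanSpace ℝ (Fin N) => y i)
          (EuclideanSpace.proj i : EuclideanSpace ℝ (Fin N) →L[ℝ] ℝ) x :=
      (EuclideanSpace.proj i : EuclideanSpace ℝ (Fin N) →L[ℝ] ℝ).hasFDerivAt
    have hp1 (x : EuclideanSpace ℝ (Fin N)) :
        fderiv ℝ (fun y : EuclideanSpace ℝ (Fin N) => y i) x (EuclideanSpace.single i 1) = 1 := by
      rw [(hp x).fderiv]
      simp
    have key := integral_mul_fderiv_eq_neg_fderiv_mul_of_integrable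
      (μ := (volume : Measure (EuclideanSpace ℝ (Fin N)))) (f := h) (g := fun y => y i)
      (v := EuclideanSpace.single i 1) (hi i)
      (by simpa only [hp1, mul_one] using hh.continuous.integrable_of_hasCompactSupport hc)
      ((hh.continuous.mul (by fun_prop)).integrable_of_hasCompactSupport hc.mul_right)
      (fun x _ => hh.differentiable one_ne_zero x)
      (fun x _ => (hp x).differentiableAt)
    simp only [hp1, mul_one] at key
    linarith
  have hsum (x : EuclideanSpace ℝ (Fin N)) :
      fderiv ℝ h x x = ∑ i, fderiv ℝ h x (EuclideanSpace.single i 1) * x i := by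
    have := congrArg (fderiv ℝ h x) ((EuclideanSpace.basisFun (Fin N) ℝ).sum_repr x)
    rw [map_sum] at this
    simpa [mul_comm] using this.symm
  simp_rw [hsum]
  rw [integral_finsetSum _ fun i _ => hi i]
  simp [hparts]

/-- Multiplying a smooth function supported in the open unit ball by a power of `(1 - |y|²)⁻¹`
yields a smooth function. -/
lemma contDiff_sq_div_one_sub_norm_sq_pow {E : Type*} [NormedAddCommGroup E]
    [InnerProductSpace ℝ E] {n : WithTop ℕ∞} {f : E → ℝ} (hf : ContDiff ℝ n f)
    (hsupp : tsupport f ⊆ Metric.ball 0 1) (k : ℕ) :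
    ContDiff ℝ n fun y => f y ^ 2 / (1 - ‖y‖ ^ 2) ^ k := by
  rw [contDiff_iff_contDiffAt]
  intro x
  by_cases hx : x ∈ tsupport f
  · have hx1 : ‖x‖ < 1 := by simpa using hsupp hx
    have hw : (1 - ‖x‖ ^ 2) ^ k ≠ 0 := pow_ne_zero _ (by nlinarith [norm_nonneg x])
    exact (hf.contDiffAt.pow 2).div ((contDiffAt_const.sub (contDiff_norm_sq ℝ).contDiffAt).pow k)
      hw
  · refine (contDiffAt_const (c := (0 : ℝ))).congr_of_eventuallyEq ?_
    filter_upwards [notMem_tsupport_iff_eventuallyEq.mp hx] with y hy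
    simp [hy]

/-- The radial derivative of `f² / (1 - |y|²)`. -/
lemma fderiv_sq_div_one_sub_norm_sq_apply_self {E : Type*} [NormedAddCommGroup E]
    [InnerProductSpace ℝ E] {f : E → ℝ} {x : E} (hf : DifferentiableAt ℝ f x)
    (hx : 1 - ‖x‖ ^ 2 ≠ 0) :
    fderiv ℝ (fun y => f y ^ 2 / (1 - ‖y‖ ^ 2) ^ 1) x x =
      2 * f x * fderiv ℝ f x x / (1 - ‖x‖ ^ 2) +
        2 * f x ^ 2 * ‖x‖ ^ 2 / (1 - ‖x‖ ^ 2) ^ 2 := by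
  have hw := ((hasStrictFDerivAt_norm_sq x).hasFDerivAt).const_sub (1 : ℝ)
  have hmul := (hf.hasFDerivAt.pow 2).mul ((hasDerivAt_inv hx).comp_hasFDerivAt x hw)
  have heq : (fun y => f y ^ 2 / (1 - ‖y‖ ^ 2) ^ 1) =
      (fun y => f y ^ 2) * (Inv.inv ∘ fun y => 1 - ‖y‖ ^ 2) := by
    ext y
    simp [div_eq_mul_inv]
  rw [heq, HasFDerivAt.fderiv hmul]
  simp
  field_simp
  ring

/-- The pointwise inequality obtained by expanding `|∇f + f x / (1 - |x|²)|² ≥ 0`. -/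
lemma sq_div_le_norm_gradient_sq_add {E : Type*} [NormedAddCommGroup E]
    [InnerProductSpace ℝ E] [CompleteSpace E] {f : E → ℝ} {x : E}
    (hf : DifferentiableAt ℝ f x) (hx : ‖x‖ < 1) {N : ℝ} (hN : 1 ≤ N) :
    f x ^ 2 / (1 - ‖x‖ ^ 2) ^ 2 ≤ ‖gradient f x‖ ^ 2 +
      fderiv ℝ (fun y => f y ^ 2 / (1 - ‖y‖ ^ 2) ^ 1) x x +
        N * (f x ^ 2 / (1 - ‖x‖ ^ 2) ^ 1) := by
  have hw : 0 < 1 - ‖x‖ ^ 2 := by nlinarith [norm_nonneg x]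
  have hg : fderiv ℝ f x x = inner ℝ (gradient f x) x := by
    simp [gradient]
  rw [fderiv_sq_div_one_sub_norm_sq_apply_self hf hw.ne', hg]
  have hsq := sq_nonneg ‖gradient f x + (f x / (1 - ‖x‖ ^ 2)) • x‖
  rw [norm_add_sq_real, norm_smul, mul_pow, Real.norm_eq_abs, sq_abs, inner_smul_right] at hsq
  have hN' : f x ^ 2 / (1 - ‖x‖ ^ 2) ≤ N * (f x ^ 2 / (1 - ‖x‖ ^ 2)) :=
    le_mul_of_one_le_left (by positivity) hN
  have hid : f x ^ 2 / (1 - ‖x‖ ^ 2) ^ 2 =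
      f x ^ 2 / (1 - ‖x‖ ^ 2) + f x ^ 2 * ‖x‖ ^ 2 / (1 - ‖x‖ ^ 2) ^ 2 := by
    field_simp
    ring
  rw [pow_one, hid]
  have h1 : 2 * (f x / (1 - ‖x‖ ^ 2) * inner ℝ (gradient f x) x) =
    2 * f x * inner ℝ (gradient f x) x / (1 - ‖x‖ ^ 2) := by ring
  have h2 : (f x / (1 - ‖x‖ ^ 2)) ^ 2 * ‖x‖ ^ 2 =
    f x ^ 2 * ‖x‖ ^ 2 / (1 - ‖x‖ ^ 2) ^ 2 := by
    rw [div_pow, div_mul_eq_mul_div]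
  have h3 : 2 * f x ^ 2 * ‖x‖ ^ 2 / (1 - ‖x‖ ^ 2) ^ 2 =
    2 * (f x ^ 2 * ‖x‖ ^ 2 / (1 - ‖x‖ ^ 2) ^ 2) := by ring
  rw [h1, h2] at hsq
  rw [h3]
  linarith

/-- Let `N ≥ 1`. There exists `C > 0` (depending only on `N`) such that
for every smooth function `f : ℝ^N → ℝ` whose support is a compact subset of the open
unit ball `B₁`, one has `∫_{B₁} f(y)²/(1 − |y|²)² dy ≤ C ∫_{B₁} |∇f(y)|² dy`. -/
theorem hardy_inequality_unit_ball (N : ℕ) (hN : 1 ≤ N) :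
    ∃ C > (0 : ℝ), ∀ f : EuclideanSpace ℝ (Fin N) → ℝ,
      ContDiff ℝ (⊤ : ℕ∞) f → HasCompactSupport f →
      tsupport f ⊆ Metric.ball (0 : EuclideanSpace ℝ (Fin N)) 1 →
      (∫ y in Metric.ball (0 : EuclideanSpace ℝ (Fin N)) 1,
          (f y) ^ 2 / (1 - ‖y‖ ^ 2) ^ 2)
        ≤ C * ∫ y in Metric.ball (0 : EuclideanSpace ℝ (Fin N)) 1, ‖gradient f y‖ ^ 2 := by
  refine ⟨1, one_pos, fun f hf hc hsupp => ?_⟩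
  have hf1 : ContDiff ℝ 1 f := hf.of_le (by exact_mod_cast le_top)
  have hquot (k : ℕ) := contDiff_sq_div_one_sub_norm_sq_pow hf1 hsupp k
  have hquotc (k : ℕ) : HasCompactSupport fun y => f y ^ 2 / (1 - ‖y‖ ^ 2) ^ k :=
    hc.mono fun y hy => by
      contrapose! hy
      simp [Function.notMem_support.mp hy]
  have hquoti (k : ℕ) := (hquot k).continuous.integrable_of_hasCompactSupport (μ := volume)
    (hquotc k)
  have hgrad : Integrable fun y => ‖gradient f y‖ ^ 2 := by
    have hn (y : EuclideanSpace ℝ (Fin N)) : ‖gradient f y‖ = ‖fderiv ℝ f y‖ := by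
      simp [gradient]
    simp_rw [hn]
    refine Continuous.integrable_of_hasCompactSupport
      ((hf1.continuous_fderiv one_ne_zero).norm.pow 2) ?_
    exact (hc.fderiv ℝ).comp_left (g := fun L => ‖L‖ ^ 2) (by simp)
  have hrad : Integrable fun y => fderiv ℝ (fun z => f z ^ 2 / (1 - ‖z‖ ^ 2) ^ 1) y y := by
    refine Continuous.integrable_of_hasCompactSupport
      (((hquot 1).continuous_fderiv one_ne_zero).clm_apply continuous_id) ?_
    refine ((hquotc 1).fderiv ℝ).mono fun y hy => ?_
    contrapose! hy
    simp only [Function.notMem_support] at hy ⊢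
    rw [hy, zero_apply]
  have houtside (y) (hy : y ∉ Metric.ball (0 : EuclideanSpace ℝ (Fin N)) 1) :
      y ∉ tsupport f := fun h => hy (hsupp h)
  rw [setIntegral_eq_integral_of_forall_compl_eq_zero (fun y hy => by
      simp [image_eq_zero_of_notMem_tsupport (houtside y hy)]),
    setIntegral_eq_integral_of_forall_compl_eq_zero (fun y hy => by
      simp [gradient, fderiv_of_notMem_tsupport ℝ (houtside y hy)]), one_mul]
  have hle : ∫ y, f y ^ 2 / (1 - ‖y‖ ^ 2) ^ 2 ≤
      ∫ y, (‖gradient f y‖ ^ 2 + fderiv ℝ (fun z => f z ^ 2 / (1 - ‖z‖ ^ 2) ^ 1) y y +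
        N * (f y ^ 2 / (1 - ‖y‖ ^ 2) ^ 1)) := by
    refine integral_mono (hquoti 2) ((hgrad.add hrad).add ((hquoti 1).const_mul _)) fun y => ?_
    by_cases hy : y ∈ tsupport f
    · exact sq_div_le_norm_gradient_sq_add (hf1.differentiable one_ne_zero y)
        (by simpa using hsupp hy) (by exact_mod_cast hN)
    · have hzero : (fun z => f z ^ 2 / (1 - ‖z‖ ^ 2) ^ 1) =ᶠ[nhds y] fun _ => (0 : ℝ) := by
        filter_upwards [notMem_tsupport_iff_eventuallyEq.mp hy] with z hz
        simp [hz]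
      simp only [hzero.fderiv_eq, image_eq_zero_of_notMem_tsupport hy]
      simp
  rw [integral_add (by exact hgrad.add hrad) ((hquoti 1).const_mul _), integral_add hgrad hrad,
    integral_const_mul, integral_fderiv_apply_self (hquot 1) (hquotc 1)] at hle
  linarith
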